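/- Let μ > 0 be fixed, y > 0, t = y cosh μ, r ∈ ℝ, ν = r + it, χ := y(sinh μ − μ cosh μ), and ψ(u) := cosh u · cos w(u) + w(u) · cosh μ evaluated along the indicated branch. Then K_ν(y) = (1/2) e^{iχ} ∫_{μ_-}^{∞} e^{−yψ(u)} e^{−ru} e^{irw(u)} (1 − i w'(u)) du + (1/2) e^{iχ} · (e^{−2πt + 2πir}/(1 − e^{−2πt + 2πir})) ∫_{−π/2}^{3π/2} e^{−yψ(u(w))} e^{−r u(w)} e^{irw} (−u'(w) + i) dw + (1/2) e^{−iχ} ∫_{μ_-}^{∞} e^{−yψ(u)} e^{ru} e^{irw(u)} (1 + i w'(u)) du − (1/2) e^{−iχ} · (e^{−2πt + 2πir}/(1 − e^{−2πt + 2πir})) ∫_{−π/2}^{3π/2} e^{−yψ(u(w))} e^{r u(w)} e^{irw} (u'(w) + i) dw, where in the du-integrals w(u) := w_B(u) for μ_- ≤ u ≤ μ and w(u) := w_A(u) for u ≥ μ, and in the dw-integrals u(w) is the inverse of w_A restricted to [μ_-, μ] for w ∈ [−π/2, π/2] and the inverse of w_B for w ∈ [π/2, 3π/2]. -/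

import Mathlib

open MeasureTheory Filter Topology

/-- The K-Bessel function, defined via the integral representation
`K_ν(y) = (1/2) ∫_{-∞}^{∞} exp(−y cosh R + ν R) dR`. -/
noncomputable def KBessel (ν : ℂ) (y : ℝ) : ℂ :=
  (1 / 2) * ∫ R : ℝ, Complex.exp (-(y : ℂ) * (Real.cosh R : ℂ) + ν * (R : ℂ))

/-- `g(u) = (u cosh μ + sinh μ − μ cosh μ)/sinh u`. -/
noncomputable def gContour (μ u : ℝ) : ℝ :=
  (u * Real.cosh μ + Real.sinh μ - μ * Real.cosh μ) / Real.sinh u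

/-- The branch `w_A(u) = arcsin(g(u))`. -/
noncomputable def wA (μ u : ℝ) : ℝ := Real.arcsin (gContour μ u)

/-- The branch `w_B(u) = π − arcsin(g(u))`. -/
noncomputable def wB (μ u : ℝ) : ℝ := Real.pi - Real.arcsin (gContour μ u)

/-- The combined branch for the `du`-integrals: `w_B` on `u ≤ μ`, `w_A` on `u ≥ μ`. -/
noncomputable def wBranch (μ u : ℝ) : ℝ := if u ≤ μ then wB μ u else wA μ u

/-- `ψ(u) = cosh u · cos w(u) + w(u) · cosh μ` along the combined branch. -/
noncomputable def ψBranch (μ u : ℝ) : ℝ :=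
  Real.cosh u * Real.cos (wBranch μ u) + wBranch μ u * Real.cosh μ

theorem Real.one_add_sq_div_two_le_cosh (u : ℝ) : 1 + u ^ 2 / 2 ≤ Real.cosh u := by
  have h1 : |u / 2| ≤ |Real.sinh (u / 2)| := by
    rw [Real.abs_sinh]
    exact Real.self_le_sinh_iff.2 (abs_nonneg _)
  have h2 := sq_le_sq.2 h1
  have h3 : Real.cosh u = Real.cosh (u / 2) ^ 2 + Real.sinh (u / 2) ^ 2 := by
    rw [← Real.cosh_two_mul]
    ring_nf
  rw [h3, Real.cosh_sq]
  linarith [div_pow u 2 2]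

theorem gContour_self {μ : ℝ} (hμ : 0 < μ) : gContour μ μ = 1 := by
  have : Real.sinh μ ≠ 0 := (Real.sinh_pos_iff.2 hμ).ne'
  simp [gContour, this]

theorem hasDerivAt_gContour (μ : ℝ) {u : ℝ} (hu : 0 < u) :
    HasDerivAt (gContour μ) ((Real.cosh μ * Real.sinh u -
      (u * Real.cosh μ + Real.sinh μ - μ * Real.cosh μ) * Real.cosh u) / Real.sinh u ^ 2) u := by
  have hs : Real.sinh u ≠ 0 := (Real.sinh_pos_iff.2 hu).ne'
  have hN : HasDerivAt (fun u : ℝ ↦ u * Real.cosh μ + Real.sinh μ - μ * Real.cosh μ)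
      (Real.cosh μ) u := by
    simpa using (((hasDerivAt_id u).mul_const (Real.cosh μ)).add_const (Real.sinh μ)).sub_const
      (μ * Real.cosh μ)
  exact hN.div (Real.hasDerivAt_sinh u) hs

theorem strictAntiOn_gContour_numerator {μ a : ℝ} (ha : 0 < a)
    (hN : 0 < a * Real.cosh μ + Real.sinh μ - μ * Real.cosh μ) :
    StrictAntiOn (fun u : ℝ ↦ Real.cosh μ * Real.sinh u -
      (u * Real.cosh μ + Real.sinh μ - μ * Real.cosh μ) * Real.cosh u) (Set.Ici a) := by
  have hd : ∀ u : ℝ, HasDerivAt (fun u : ℝ ↦ Real.cosh μ * Real.sinh u -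
      (u * Real.cosh μ + Real.sinh μ - μ * Real.cosh μ) * Real.cosh u)
      (-((u * Real.cosh μ + Real.sinh μ - μ * Real.cosh μ) * Real.sinh u)) u := by
    intro u
    have hN : HasDerivAt (fun u : ℝ ↦ u * Real.cosh μ + Real.sinh μ - μ * Real.cosh μ)
        (Real.cosh μ) u := by
      simpa using (((hasDerivAt_id u).mul_const (Real.cosh μ)).add_const (Real.sinh μ)).sub_const
        (μ * Real.cosh μ)
    refine (((Real.hasDerivAt_sinh u).const_mul (Real.cosh μ)).sub
      (hN.mul (Real.hasDerivAt_cosh u))).congr_deriv ?_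
    ring
  refine strictAntiOn_of_deriv_neg (convex_Ici a)
    (fun u _ ↦ (hd u).continuousAt.continuousWithinAt) fun u hu ↦ ?_
  rw [interior_Ici, Set.mem_Ioi] at hu
  rw [(hd u).deriv, neg_neg_iff_pos]
  have := mul_lt_mul_of_pos_right hu (Real.cosh_pos μ)
  exact mul_pos (by linarith) (Real.sinh_pos_iff.2 (ha.trans hu))

theorem gContour_deriv_pos {μ u : ℝ} (hu : 0 < u) (huμ : u < μ) :
    0 < (Real.cosh μ * Real.sinh u -
      (u * Real.cosh μ + Real.sinh μ - μ * Real.cosh μ) * Real.cosh u) / Real.sinh u ^ 2 := by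
  have hs := Real.sinh_pos_iff.2 hu
  refine div_pos ?_ (by positivity)
  rcases le_or_gt (u * Real.cosh μ + Real.sinh μ - μ * Real.cosh μ) 0 with hN | hN
  · have h1 := mul_nonneg (neg_nonneg.2 hN) (Real.cosh_pos u).le
    have h2 := mul_pos (Real.cosh_pos μ) hs
    linarith
  · have := strictAntiOn_gContour_numerator hu hN (Set.mem_Ici.2 le_rfl) (Set.mem_Ici.2 huμ.le) huμ
    simp only [add_sub_cancel_left] at this
    linarith

theorem gContour_deriv_neg {μ u : ℝ} (hμ : 0 < μ) (huμ : μ < u) :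
    (Real.cosh μ * Real.sinh u -
      (u * Real.cosh μ + Real.sinh μ - μ * Real.cosh μ) * Real.cosh u) / Real.sinh u ^ 2 < 0 := by
  have hs := Real.sinh_pos_iff.2 (hμ.trans huμ)
  refine div_neg_of_neg_of_pos ?_ (by positivity)
  have := strictAntiOn_gContour_numerator (μ := μ) hμ (by simpa using hμ)
    (Set.mem_Ici.2 le_rfl) (Set.mem_Ici.2 huμ.le) huμ
  simp only [add_sub_cancel_left] at this
  linarith

theorem strictMonoOn_gContour (μ : ℝ) : StrictMonoOn (gContour μ) (Set.Ioc 0 μ) := by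
  refine strictMonoOn_of_deriv_pos (convex_Ioc 0 μ)
    (fun u hu ↦ (hasDerivAt_gContour μ hu.1).continuousAt.continuousWithinAt) fun u hu ↦ ?_
  rw [interior_Ioc] at hu
  rw [(hasDerivAt_gContour μ hu.1).deriv]
  exact gContour_deriv_pos hu.1 hu.2

theorem strictAntiOn_gContour {μ : ℝ} (hμ : 0 < μ) :
    StrictAntiOn (gContour μ) (Set.Ici μ) := by
  refine strictAntiOn_of_deriv_neg (convex_Ici μ) (fun u hu ↦ (hasDerivAt_gContour μ
    (hμ.trans_le hu)).continuousAt.continuousWithinAt) fun u hu ↦ ?_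
  rw [interior_Ici] at hu
  rw [(hasDerivAt_gContour μ (hμ.trans hu)).deriv]
  exact gContour_deriv_neg hμ hu

theorem gContour_mem_Ioo_of_lt {μ μm u : ℝ} (hμm : 0 < μm) (hg : gContour μ μm = -1)
    (hu : u ∈ Set.Ioo μm μ) : gContour μ u ∈ Set.Ioo (-1) 1 := by
  have hu0 := hμm.trans hu.1
  have hμ := hu0.trans hu.2
  have h1 := strictMonoOn_gContour μ ⟨hμm, (hu.1.trans hu.2).le⟩ ⟨hu0, hu.2.le⟩ hu.1
  have h2 := strictMonoOn_gContour μ ⟨hu0, hu.2.le⟩ ⟨hμ, le_rfl⟩ hu.2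
  rw [hg] at h1
  rw [gContour_self hμ] at h2
  exact ⟨h1, h2⟩

theorem gContour_mem_Ioo_of_gt {μ u : ℝ} (hμ : 0 < μ) (hu : μ < u) :
    gContour μ u ∈ Set.Ioo 0 1 := by
  constructor
  · refine div_pos ?_ (Real.sinh_pos_iff.2 (hμ.trans hu))
    have := mul_lt_mul_of_pos_right hu (Real.cosh_pos μ)
    have := Real.sinh_pos_iff.2 hμ
    linarith
  · have h2 := strictAntiOn_gContour hμ (Set.mem_Ici.2 le_rfl) (Set.mem_Ici.2 hu.le) hu
    rwa [gContour_self hμ] at h2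

theorem gContour_mem_Icc {μ μm u : ℝ} (hμm : 0 < μm) (hμmμ : μm < μ) (hg : gContour μ μm = -1)
    (hu : μm ≤ u) : gContour μ u ∈ Set.Icc (-1) 1 := by
  rcases hu.eq_or_lt with rfl | hu
  · simp [hg]
  rcases lt_trichotomy u μ with h | rfl | h
  · exact Set.Ioo_subset_Icc_self (gContour_mem_Ioo_of_lt hμm hg ⟨hu, h⟩)
  · simp [gContour_self (hμm.trans hμmμ)]
  · have := gContour_mem_Ioo_of_gt (hμm.trans hμmμ) h
    exact ⟨by linarith [this.1], this.2.le⟩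

theorem tendsto_gContour_atTop (μ : ℝ) : Tendsto (gContour μ) atTop (𝓝 0) := by
  have key : ∀ u : ℝ, 0 < u → u ^ 3 / 8 ≤ Real.sinh u := by
    intro u hu
    have h1 : u / 2 ≤ Real.sinh (u / 2) := Real.self_le_sinh_iff.2 (by positivity)
    have h2 : Real.sinh u = 2 * Real.sinh (u / 2) * Real.cosh (u / 2) := by
      rw [← Real.sinh_two_mul]; ring_nf
    have h3 := Real.one_add_sq_div_two_le_cosh (u / 2)
    have h6 : u ^ 2 / 8 ≤ Real.cosh (u / 2) := by linarith [div_pow u 2 2]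
    calc u ^ 3 / 8 = 2 * (u / 2) * (u ^ 2 / 8) := by ring
      _ ≤ 2 * Real.sinh (u / 2) * Real.cosh (u / 2) := by gcongr
      _ = _ := h2.symm
  have hs : Tendsto (fun u : ℝ ↦ Real.sinh u) atTop atTop :=
    tendsto_atTop_mono' _ (by
      filter_upwards [eventually_ge_atTop 0] with u hu using Real.self_le_sinh_iff.2 hu) tendsto_id
  have h1 : Tendsto (fun u : ℝ ↦ u / Real.sinh u) atTop (𝓝 0) := by
    have h8 : Tendsto (fun u : ℝ ↦ 8 / u ^ 2) atTop (𝓝 0) :=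
      tendsto_const_nhds.div_atTop (tendsto_pow_atTop two_ne_zero)
    refine tendsto_of_tendsto_of_tendsto_of_le_of_le' tendsto_const_nhds h8 ?_ ?_
    · filter_upwards [eventually_gt_atTop 0] with u hu
      exact div_nonneg hu.le (Real.sinh_pos_iff.2 hu).le
    · filter_upwards [eventually_gt_atTop 0] with u hu
      rw [div_le_div_iff₀ (Real.sinh_pos_iff.2 hu) (by positivity)]
      linarith [key u hu]
  have h2 : Tendsto (fun u : ℝ ↦ (Real.sinh μ - μ * Real.cosh μ) / Real.sinh u) atTop (𝓝 0) :=
    tendsto_const_nhds.div_atTop hs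
  have := (h1.mul_const (Real.cosh μ)).add h2
  simp only [zero_mul, add_zero] at this
  refine this.congr fun u ↦ ?_
  rw [gContour]
  ring

theorem sinh_mul_gContour (μ : ℝ) {u : ℝ} (hu : 0 < u) :
    Real.sinh u * gContour μ u = u * Real.cosh μ + Real.sinh μ - μ * Real.cosh μ :=
  mul_div_cancel₀ _ (Real.sinh_pos_iff.2 hu).ne'

theorem continuousOn_wA (μ : ℝ) : ContinuousOn (wA μ) (Set.Ioi 0) := fun _ hu ↦
  (Real.continuous_arcsin.continuousAt.comp
    (hasDerivAt_gContour μ hu).continuousAt).continuousWithinAt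

theorem wA_self {μ : ℝ} (hμ : 0 < μ) : wA μ μ = Real.pi / 2 := by
  rw [wA, gContour_self hμ, Real.arcsin_one]

theorem exists_hasDerivAt_wA_of_lt {μ μm u : ℝ} (hμm : 0 < μm) (hg : gContour μ μm = -1)
    (hu : u ∈ Set.Ioo μm μ) : ∃ d : ℝ, 0 < d ∧ HasDerivAt (wA μ) d u := by
  have h := gContour_mem_Ioo_of_lt hμm hg hu
  have hu0 := hμm.trans hu.1
  have h1 : 0 < 1 - gContour μ u ^ 2 := by nlinarith [h.1, h.2]
  exact ⟨_, mul_pos (by positivity) (gContour_deriv_pos hu0 hu.2),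
    (Real.hasDerivAt_arcsin h.1.ne' h.2.ne).comp u (hasDerivAt_gContour μ hu0)⟩

theorem exists_hasDerivAt_wA_of_gt {μ u : ℝ} (hμ : 0 < μ) (hu : μ < u) :
    ∃ d : ℝ, d < 0 ∧ HasDerivAt (wA μ) d u := by
  have h := gContour_mem_Ioo_of_gt hμ hu
  have h1 : 0 < 1 - gContour μ u ^ 2 := by nlinarith [h.1, h.2]
  exact ⟨_, mul_neg_of_pos_of_neg (by positivity) (gContour_deriv_neg hμ hu),
    (Real.hasDerivAt_arcsin (by linarith [h.1]) h.2.ne).comp u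
      (hasDerivAt_gContour μ (hμ.trans hu))⟩

theorem tendsto_wA_atTop (μ : ℝ) : Tendsto (wA μ) atTop (𝓝 0) := by
  have h := (Real.continuous_arcsin.tendsto 0).comp (tendsto_gContour_atTop μ)
  rwa [Real.arcsin_zero] at h

theorem continuousOn_wA_inverse {μ μm : ℝ} {V : ℝ → ℝ} (hμm : 0 < μm) (hμmμ : μm < μ)
    (hg : gContour μ μm = -1)
    (hV : ∀ w ∈ Set.Icc (-(Real.pi / 2)) (Real.pi / 2), V w ∈ Set.Icc μm μ ∧ wA μ (V w) = w) :
    ContinuousOn V (Set.Icc (-(Real.pi / 2)) (Real.pi / 2)) := by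
  have hmono : StrictMonoOn (wA μ) (Set.Icc μm μ) := by
    intro a ha b hb hab
    exact Real.strictMonoOn_arcsin (gContour_mem_Icc hμm hμmμ hg ha.1)
      (gContour_mem_Icc hμm hμmμ hg hb.1)
      (strictMonoOn_gContour μ ⟨hμm.trans_le ha.1, ha.2⟩ ⟨hμm.trans_le hb.1, hb.2⟩ hab)
  have hmaps : Set.MapsTo V (Set.Icc (-(Real.pi / 2)) (Real.pi / 2)) (Set.Icc μm μ) :=
    fun w hw ↦ (hV w hw).1
  have hVmono : Monotone hmaps.restrict := by
    rintro ⟨w, hw⟩ ⟨w', hw'⟩ hww'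
    by_contra hlt
    have hlt : V w' < V w := not_le.1 hlt
    have := hmono (hV w' hw').1 (hV w hw).1 hlt
    rw [(hV w hw).2, (hV w' hw').2] at this
    exact this.not_ge hww'
  have hVsurj : Function.Surjective hmaps.restrict := by
    rintro ⟨u, hu⟩
    have hw : wA μ u ∈ Set.Icc (-(Real.pi / 2)) (Real.pi / 2) := Real.arcsin_mem_Icc _
    exact ⟨⟨wA μ u, hw⟩, Subtype.ext (hmono.injOn (hV _ hw).1 hu (hV _ hw).2)⟩
  exact continuousOn_iff_continuous_domRestrict.2
    (continuous_subtype_val.comp (hVmono.continuous_of_surjective hVsurj))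

theorem exists_hasDerivAt_wA_inverse {μ μm w : ℝ} {V : ℝ → ℝ} (hμm : 0 < μm) (hμmμ : μm < μ)
    (hg : gContour μ μm = -1)
    (hV : ∀ w ∈ Set.Icc (-(Real.pi / 2)) (Real.pi / 2), V w ∈ Set.Icc μm μ ∧ wA μ (V w) = w)
    (hw : w ∈ Set.Ioo (-(Real.pi / 2)) (Real.pi / 2)) : ∃ d : ℝ, 0 < d ∧ HasDerivAt V d w := by
  obtain ⟨hmem, hval⟩ := hV w (Set.Ioo_subset_Icc_self hw)
  have hIoo : V w ∈ Set.Ioo μm μ := by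
    refine ⟨lt_of_le_of_ne hmem.1 fun h ↦ ?_, lt_of_le_of_ne hmem.2 fun h ↦ ?_⟩
    · rw [← h, wA, hg, Real.arcsin_neg_one] at hval
      exact hw.1.ne hval
    · rw [h, wA_self (hμm.trans hμmμ)] at hval
      exact hw.2.ne' hval
  obtain ⟨d, hd, hder⟩ := exists_hasDerivAt_wA_of_lt hμm hg hIoo
  have hnhds : Set.Icc (-(Real.pi / 2)) (Real.pi / 2) ∈ 𝓝 w := Icc_mem_nhds hw.1 hw.2
  exact ⟨d⁻¹, inv_pos.2 hd, HasDerivAt.of_local_left_inverse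
    ((continuousOn_wA_inverse hμm hμmμ hg hV).continuousAt hnhds) hder hd.ne'
    (Filter.mem_of_superset hnhds fun x hx ↦ (hV x hx).2)⟩

theorem wB_inverse_comp_pi_sub {μ μm : ℝ} {U : ℝ → ℝ}
    (hU : ∀ w ∈ Set.Icc (Real.pi / 2) (3 * Real.pi / 2), U w ∈ Set.Icc μm μ ∧ wB μ (U w) = w) :
    ∀ w ∈ Set.Icc (-(Real.pi / 2)) (Real.pi / 2),
      U (Real.pi - w) ∈ Set.Icc μm μ ∧ wA μ (U (Real.pi - w)) = w := by
  intro w hw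
  obtain ⟨h1, h2⟩ := hU (Real.pi - w) ⟨by linarith [hw.2], by linarith [hw.1]⟩
  refine ⟨h1, ?_⟩
  rw [wB] at h2
  rw [wA]
  linarith

theorem continuousOn_wB_inverse {μ μm : ℝ} {U : ℝ → ℝ} (hμm : 0 < μm) (hμmμ : μm < μ)
    (hg : gContour μ μm = -1)
    (hU : ∀ w ∈ Set.Icc (Real.pi / 2) (3 * Real.pi / 2), U w ∈ Set.Icc μm μ ∧ wB μ (U w) = w) :
    ContinuousOn U (Set.Icc (Real.pi / 2) (3 * Real.pi / 2)) := by
  have h := (continuousOn_wA_inverse hμm hμmμ hg (wB_inverse_comp_pi_sub hU)).comp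
    (f := fun w : ℝ ↦ Real.pi - w) (by fun_prop)
    (s := Set.Icc (Real.pi / 2) (3 * Real.pi / 2))
    fun w hw ↦ ⟨by linarith [hw.2], by linarith [hw.1]⟩
  exact h.congr fun w _ ↦ by simp

theorem exists_hasDerivAt_wB_inverse {μ μm w : ℝ} {U : ℝ → ℝ} (hμm : 0 < μm) (hμmμ : μm < μ)
    (hg : gContour μ μm = -1)
    (hU : ∀ w ∈ Set.Icc (Real.pi / 2) (3 * Real.pi / 2), U w ∈ Set.Icc μm μ ∧ wB μ (U w) = w)
    (hw : w ∈ Set.Ioo (Real.pi / 2) (3 * Real.pi / 2)) : ∃ d : ℝ, d < 0 ∧ HasDerivAt U d w := by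
  obtain ⟨d, hd, hder⟩ := exists_hasDerivAt_wA_inverse hμm hμmμ hg (wB_inverse_comp_pi_sub hU)
    (w := Real.pi - w) ⟨by linarith [hw.2], by linarith [hw.1]⟩
  refine ⟨-d, neg_neg_iff_pos.2 hd, ?_⟩
  simpa using hder.comp_const_sub Real.pi w

theorem wBranch_of_le {μ u : ℝ} (hu : u ≤ μ) : wBranch μ u = Real.pi - wA μ u := if_pos hu

theorem wBranch_of_ge {μ u : ℝ} (hμ : 0 < μ) (hu : μ ≤ u) : wBranch μ u = wA μ u := by
  rcases hu.eq_or_lt with rfl | hu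
  · rw [wBranch_of_le le_rfl, wA_self hμ]
    ring
  · exact if_neg hu.not_ge

theorem wBranch_start {μ μm : ℝ} (hμmμ : μm < μ) (hg : gContour μ μm = -1) :
    wBranch μ μm = 3 * Real.pi / 2 := by
  rw [wBranch_of_le hμmμ.le, wA, hg, Real.arcsin_neg_one]
  ring

theorem sinh_mul_sin_wBranch {μ μm u : ℝ} (hμm : 0 < μm) (hμmμ : μm < μ)
    (hg : gContour μ μm = -1) (hu : μm ≤ u) :
    Real.sinh u * Real.sin (wBranch μ u) = u * Real.cosh μ + Real.sinh μ - μ * Real.cosh μ := by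
  have h := gContour_mem_Icc hμm hμmμ hg hu
  rw [← sinh_mul_gContour μ (hμm.trans_le hu), wBranch, wA, wB]
  split_ifs
  · rw [Real.sin_pi_sub, Real.sin_arcsin h.1 h.2]
  · rw [Real.sin_arcsin h.1 h.2]

theorem continuousOn_wBranch {μ μm : ℝ} (hμm : 0 < μm) (hμmμ : μm < μ) :
    ContinuousOn (wBranch μ) (Set.Ici μm) := by
  have hμ := hμm.trans hμmμ
  have h1 : ContinuousOn (wBranch μ) (Set.Icc μm μ) :=
    (continuousOn_const.sub ((continuousOn_wA μ).mono fun u hu ↦ hμm.trans_le hu.1)).congr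
      fun u hu ↦ wBranch_of_le hu.2
  have h2 : ContinuousOn (wBranch μ) (Set.Ici μ) :=
    ((continuousOn_wA μ).mono fun u hu ↦ hμ.trans_le hu).congr fun u hu ↦ wBranch_of_ge hμ hu
  rw [← Set.Icc_union_Ici_eq_Ici hμmμ.le]
  exact h1.union_of_isClosed h2 isClosed_Icc isClosed_Ici

theorem exists_hasDerivAt_wBranch {μ μm u : ℝ} (hμm : 0 < μm) (hμmμ : μm < μ)
    (hg : gContour μ μm = -1) (hu : μm < u) (hne : u ≠ μ) :
    ∃ d : ℝ, d < 0 ∧ HasDerivAt (wBranch μ) d u := by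
  rcases hne.lt_or_gt with h | h
  · obtain ⟨d, hd, hder⟩ := exists_hasDerivAt_wA_of_lt hμm hg ⟨hu, h⟩
    refine ⟨-d, neg_neg_iff_pos.2 hd, (hder.const_sub Real.pi).congr_of_eventuallyEq ?_⟩
    filter_upwards [Iio_mem_nhds h] with v hv using wBranch_of_le hv.le
  · obtain ⟨d, hd, hder⟩ := exists_hasDerivAt_wA_of_gt (hμm.trans hμmμ) h
    refine ⟨d, hd, hder.congr_of_eventuallyEq ?_⟩
    filter_upwards [Ioi_mem_nhds h] with v hv using wBranch_of_ge (hμm.trans hμmμ) hv.le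

theorem tendsto_wBranch_atTop {μ : ℝ} (hμ : 0 < μ) : Tendsto (wBranch μ) atTop (𝓝 0) := by
  refine (tendsto_wA_atTop μ).congr' ?_
  filter_upwards [eventually_ge_atTop μ] with u hu using (wBranch_of_ge hμ hu).symm

theorem eventually_wBranch_mem_Icc {μ : ℝ} (hμ : 0 < μ) :
    ∀ᶠ u in atTop, wBranch μ u ∈ Set.Icc 0 (Real.pi / 3) := by
  filter_upwards [(tendsto_wBranch_atTop hμ).eventually_le_const
    (show (0 : ℝ) < Real.pi / 3 by positivity), eventually_gt_atTop μ] with u hu hu'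
  refine ⟨?_, hu⟩
  rw [wBranch_of_ge hμ hu'.le]
  exact Real.arcsin_nonneg.2 (gContour_mem_Ioo_of_gt hμ hu').1.le

/-- The holomorphic integrand of the integral representation defining the K-Bessel function. -/
noncomputable def besselIntegrand (ν : ℂ) (y : ℝ) (z : ℂ) : ℂ :=
  Complex.exp (-(y : ℂ) * Complex.cosh z + ν * z)

theorem differentiable_besselIntegrand (ν : ℂ) (y : ℝ) :
    Differentiable ℂ (besselIntegrand ν y) := by
  unfold besselIntegrand
  fun_prop

theorem exists_hasDerivAt_besselIntegrand (ν : ℂ) (y : ℝ) :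
    ∃ Φ : ℂ → ℂ, ∀ z, HasDerivAt Φ (besselIntegrand ν y z) z := by
  obtain ⟨Φ, hΦ⟩ := (differentiable_besselIntegrand ν y).isExactOn_univ
  exact ⟨Φ, fun z ↦ hΦ z (Set.mem_univ z)⟩

theorem besselIntegrand_add_two_pi_mul_I (ν : ℂ) (y : ℝ) (z : ℂ) :
    besselIntegrand ν y (z + 2 * Real.pi * Complex.I) =
      Complex.exp (2 * Real.pi * ν * Complex.I) * besselIntegrand ν y z := by
  have hcosh : Complex.cosh (z + 2 * Real.pi * Complex.I) = Complex.cosh z := by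
    rw [Complex.cosh_add, Complex.cosh_mul_I, Complex.sinh_mul_I]
    simp
  rw [besselIntegrand, besselIntegrand, hcosh, ← Complex.exp_add]
  ring_nf

theorem primitive_besselIntegrand_add_two_pi_mul_I {ν : ℂ} {y : ℝ} {Φ : ℂ → ℂ}
    (hΦ : ∀ z, HasDerivAt Φ (besselIntegrand ν y z) z) (z z' : ℂ) :
    Φ (z + 2 * Real.pi * Complex.I) - Complex.exp (2 * Real.pi * ν * Complex.I) * Φ z =
      Φ (z' + 2 * Real.pi * Complex.I) - Complex.exp (2 * Real.pi * ν * Complex.I) * Φ z' := by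
  have hd : ∀ z, HasDerivAt (fun z ↦ Φ (z + 2 * Real.pi * Complex.I) -
      Complex.exp (2 * Real.pi * ν * Complex.I) * Φ z) 0 z := by
    intro z
    refine (((hΦ (z + 2 * Real.pi * Complex.I)).comp_add_const z _).sub
      ((hΦ z).const_mul _)).congr_deriv ?_
    rw [besselIntegrand_add_two_pi_mul_I, sub_self]
  exact is_const_of_deriv_eq_zero (fun z ↦ (hd z).differentiableAt) (fun z ↦ (hd z).deriv) z z'

theorem besselIntegrand_of_sinh_mul_sin {μ y r u w σ : ℝ} (hσ : σ = 1 ∨ σ = -1)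
    (h : Real.sinh u * Real.sin w = u * Real.cosh μ + Real.sinh μ - μ * Real.cosh μ) :
    besselIntegrand ((r : ℂ) + ((y * Real.cosh μ : ℝ) : ℂ) * Complex.I) y
        ((σ * u : ℝ) + (w : ℂ) * Complex.I) =
      Complex.exp (-(σ : ℂ) * (Complex.I *
          ((y * (Real.sinh μ - μ * Real.cosh μ) : ℝ) : ℂ))) *
        (Complex.exp (-(y : ℂ) * ((Real.cosh u * Real.cos w + w * Real.cosh μ : ℝ) : ℂ)) *
          Complex.exp ((σ * r : ℝ) * (u : ℂ)) * Complex.exp (Complex.I * (r : ℂ) * (w : ℂ))) := by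
  have hcosh : Complex.cosh ((σ * u : ℝ) + (w : ℂ) * Complex.I) =
      (Real.cosh u : ℂ) * (Real.cos w : ℂ) +
        (σ : ℂ) * ((Real.sinh u * Real.sin w : ℝ) : ℂ) * Complex.I := by
    rw [Complex.cosh_add, Complex.cosh_mul_I, Complex.sinh_mul_I]
    rcases hσ with rfl | rfl <;> push_cast <;> simp only [one_mul, neg_mul, Complex.cosh_neg,
      Complex.sinh_neg] <;> ring
  rw [besselIntegrand, hcosh, h]
  simp only [← Complex.exp_add]
  congr 1
  push_cast
  linear_combination (y : ℂ) * Complex.cosh μ * w * Complex.I_sq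

theorem norm_besselIntegrand (r t y u w : ℝ) :
    ‖besselIntegrand ((r : ℂ) + (t : ℂ) * Complex.I) y ((u : ℂ) + (w : ℂ) * Complex.I)‖ =
      Real.exp (-y * (Real.cosh u * Real.cos w) + r * u - t * w) := by
  rw [besselIntegrand, Complex.norm_exp, Complex.cosh_add, Complex.cosh_mul_I, Complex.sinh_mul_I,
    ← Complex.ofReal_cosh, ← Complex.ofReal_sinh, ← Complex.ofReal_cos, ← Complex.ofReal_sin]
  congr 1
  simp [-Complex.ofReal_cosh, -Complex.ofReal_sinh, -Complex.ofReal_cos, -Complex.ofReal_sin]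
  ring

theorem norm_besselIntegrand_le {r t y u w : ℝ} (hy : 0 < y) (ht : 0 ≤ t)
    (hw : w ∈ Set.Icc 0 (Real.pi / 3)) :
    ‖besselIntegrand ((r : ℂ) + (t : ℂ) * Complex.I) y ((u : ℂ) + (w : ℂ) * Complex.I)‖ ≤
      Real.exp (2 * r ^ 2 / y) * Real.exp (-(y / 8) * u ^ 2) := by
  rw [norm_besselIntegrand, ← Real.exp_add, Real.exp_le_exp]
  have hcos : 1 / 2 ≤ Real.cos w := by
    rw [← Real.cos_pi_div_three]
    exact Real.cos_le_cos_of_nonneg_of_le_pi hw.1 (by linarith [Real.pi_pos]) hw.2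
  have hcosh := Real.one_add_sq_div_two_le_cosh u
  have h1 : (u ^ 2 / 2) * (1 / 2) ≤ Real.cosh u * Real.cos w := by
    gcongr
    linarith
  have h2 := mul_le_mul_of_nonneg_left h1 hy.le
  have h3 : r * u ≤ 2 * r ^ 2 / y + y / 8 * u ^ 2 := by
    have : 2 * r ^ 2 / y + y / 8 * u ^ 2 - r * u = (4 * r - y * u) ^ 2 / (8 * y) := by
      field_simp
      ring
    linarith [show 0 ≤ (4 * r - y * u) ^ 2 / (8 * y) by positivity]
  linarith [mul_nonneg ht hw.1]

theorem integrable_gaussian_bound {y : ℝ} (hy : 0 < y) (r : ℝ) :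
    Integrable fun u : ℝ ↦ Real.exp (2 * r ^ 2 / y) * Real.exp (-(y / 8) * u ^ 2) :=
  (integrable_exp_neg_mul_sq (by positivity)).const_mul _

theorem tendsto_gaussian_bound {y : ℝ} (hy : 0 < y) (r : ℝ) :
    Tendsto (fun u : ℝ ↦ Real.exp (2 * r ^ 2 / y) * Real.exp (-(y / 8) * u ^ 2)) atTop (𝓝 0) := by
  have h : Tendsto (fun u : ℝ ↦ -(y / 8) * u ^ 2) atTop atBot :=
    (tendsto_pow_atTop two_ne_zero).const_mul_atTop_of_neg (by linarith)
  simpa using (Real.tendsto_exp_atBot.comp h).const_mul (Real.exp (2 * r ^ 2 / y))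

theorem intervalIntegrable_deriv_of_sign {p : ℝ → ℝ} {a b : ℝ} (hab : a ≤ b)
    (hp : ContinuousOn p (Set.Icc a b))
    (hp' : (∀ x ∈ Set.Ioo a b, ∃ d : ℝ, 0 < d ∧ HasDerivAt p d x) ∨
      ∀ x ∈ Set.Ioo a b, ∃ d : ℝ, d < 0 ∧ HasDerivAt p d x) :
    (∀ x ∈ Set.Ioo a b, HasDerivAt p (deriv p x) x) ∧
      IntervalIntegrable (deriv p) volume a b := by
  rw [intervalIntegrable_iff_integrableOn_Ioc_of_le hab]
  rcases hp' with h | h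
  · have hd : ∀ x ∈ Set.Ioo a b, HasDerivAt p (deriv p x) x ∧ 0 ≤ deriv p x := fun x hx ↦ by
      obtain ⟨d, hd, hder⟩ := h x hx
      exact ⟨hder.differentiableAt.hasDerivAt, by rw [hder.deriv]; exact hd.le⟩
    exact ⟨fun x hx ↦ (hd x hx).1, intervalIntegral.integrableOn_deriv_of_nonneg hp
      (fun x hx ↦ (hd x hx).1) fun x hx ↦ (hd x hx).2⟩
  · have hd : ∀ x ∈ Set.Ioo a b, HasDerivAt p (deriv p x) x ∧ 0 ≤ -deriv p x := fun x hx ↦ by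
      obtain ⟨d, hd, hder⟩ := h x hx
      exact ⟨hder.differentiableAt.hasDerivAt, by rw [hder.deriv]; linarith⟩
    refine ⟨fun x hx ↦ (hd x hx).1, ?_⟩
    simpa using (intervalIntegral.integrableOn_deriv_of_nonneg hp.neg
      (fun x hx ↦ (hd x hx).1.neg) fun x hx ↦ (hd x hx).2).neg

theorem integral_comp_mul_deriv_curve {Φ F : ℂ → ℂ} {z z' : ℝ → ℂ} {a b : ℝ} (hab : a ≤ b)
    (hΦ : ∀ z, HasDerivAt Φ (F z) z) (hF : Continuous F) (hz : ContinuousOn z (Set.Icc a b))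
    (hz' : ∀ x ∈ Set.Ioo a b, HasDerivAt z (z' x) x) (hint : IntervalIntegrable z' volume a b) :
    IntervalIntegrable (fun x ↦ F (z x) * z' x) volume a b ∧
      ∫ x in a..b, F (z x) * z' x = Φ (z b) - Φ (z a) := by
  have hΦc : Continuous Φ := continuous_iff_continuousAt.2 fun z ↦ (hΦ z).continuousAt
  have hi : IntervalIntegrable (fun x ↦ F (z x) * z' x) volume a b :=
    hint.continuousOn_mul (by rw [Set.uIcc_of_le hab]; exact hF.comp_continuousOn hz)
  exact ⟨hi, intervalIntegral.integral_eq_sub_of_hasDerivAt_of_le hab (hΦc.comp_continuousOn hz)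
    (fun x hx ↦ (hΦ (z x)).comp x (hz' x hx)) hi⟩

theorem integral_besselIntegrand_wBranch_interval {μ μm a b σ y : ℝ} {ν : ℂ} {Φ : ℂ → ℂ}
    (hμm : 0 < μm) (hμmμ : μm < μ) (hg : gContour μ μm = -1)
    (hΦ : ∀ z, HasDerivAt Φ (besselIntegrand ν y z) z) (ha : μm ≤ a) (hab : a ≤ b)
    (hμ : μ ∉ Set.Ioo a b) :
    IntegrableOn (fun u : ℝ ↦ besselIntegrand ν y ((σ * u : ℝ) + (wBranch μ u : ℂ) * Complex.I) *
        ((σ : ℂ) + ((deriv (wBranch μ) u : ℝ) : ℂ) * Complex.I)) (Set.Ioc a b) ∧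
      ∫ u in Set.Ioc a b, besselIntegrand ν y ((σ * u : ℝ) + (wBranch μ u : ℂ) * Complex.I) *
        ((σ : ℂ) + ((deriv (wBranch μ) u : ℝ) : ℂ) * Complex.I) =
      Φ ((σ * b : ℝ) + (wBranch μ b : ℂ) * Complex.I) -
        Φ ((σ * a : ℝ) + (wBranch μ a : ℂ) * Complex.I) := by
  have hc : ContinuousOn (wBranch μ) (Set.Icc a b) :=
    (continuousOn_wBranch hμm hμmμ).mono fun u hu ↦ ha.trans hu.1
  obtain ⟨hd, hi⟩ := intervalIntegrable_deriv_of_sign hab hc <| Or.inr fun u hu ↦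
    exists_hasDerivAt_wBranch hμm hμmμ hg (ha.trans_lt hu.1) fun h ↦ hμ (h ▸ hu)
  rw [← intervalIntegral.integral_of_le hab, ← intervalIntegrable_iff_integrableOn_Ioc_of_le hab]
  refine integral_comp_mul_deriv_curve hab hΦ (differentiable_besselIntegrand ν y).continuous
    (z := fun u : ℝ ↦ (σ * u : ℝ) + (wBranch μ u : ℂ) * Complex.I) ?_ (fun u hu ↦ ?_) ?_
  · have := Complex.continuous_ofReal.comp_continuousOn hc
    exact ContinuousOn.add (by fun_prop) (this.mul continuousOn_const)
  · have h1 := ((hasDerivAt_id u).const_mul σ).ofReal_comp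
    simp only [mul_one] at h1
    exact h1.add ((hd u hu).ofReal_comp.mul_const _)
  · have hi' : IntervalIntegrable (fun u ↦ ((deriv (wBranch μ) u : ℝ) : ℂ)) volume a b := by
      rw [intervalIntegrable_iff] at hi ⊢
      exact hi.ofReal
    exact intervalIntegrable_const.add (hi'.mul_const _)

theorem tendsto_primitive_besselIntegrand_wBranch {μ y r t σ : ℝ} {Φ : ℂ → ℂ} {L : ℂ} (hμ : 0 < μ)
    (hy : 0 < y) (ht : 0 ≤ t) (hσ : σ = 1 ∨ σ = -1)
    (hΦ : ∀ z, HasDerivAt Φ (besselIntegrand ((r : ℂ) + (t : ℂ) * Complex.I) y z) z)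
    (hL : Tendsto (fun u : ℝ ↦ Φ ((σ * u : ℝ) : ℂ)) atTop (𝓝 L)) :
    Tendsto (fun u : ℝ ↦ Φ ((σ * u : ℝ) + (wBranch μ u : ℂ) * Complex.I)) atTop (𝓝 L) := by
  have hσ2 : σ ^ 2 = 1 := by rcases hσ with rfl | rfl <;> norm_num
  have hdiff : Tendsto (fun u : ℝ ↦ Φ ((σ * u : ℝ) + (wBranch μ u : ℂ) * Complex.I) -
      Φ ((σ * u : ℝ) : ℂ)) atTop (𝓝 0) := by
    have h0 := (tendsto_gaussian_bound hy r).mul_const (Real.pi / 3)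
    rw [zero_mul] at h0
    refine squeeze_zero_norm' ?_ h0
    filter_upwards [eventually_wBranch_mem_Icc hμ] with u hu
    have hmem0 : (0 : ℝ) ∈ Set.Icc 0 (Real.pi / 3) := ⟨le_rfl, by positivity⟩
    have hd : ∀ s ∈ Set.Icc 0 (Real.pi / 3), HasDerivWithinAt
        (fun s : ℝ ↦ Φ ((σ * u : ℝ) + (s : ℂ) * Complex.I))
        (besselIntegrand ((r : ℂ) + (t : ℂ) * Complex.I) y ((σ * u : ℝ) + (s : ℂ) * Complex.I) *
          Complex.I) (Set.Icc 0 (Real.pi / 3)) s := by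
      intro s _
      have h1 : HasDerivAt (fun s : ℝ ↦ ((σ * u : ℝ) : ℂ) + (s : ℂ) * Complex.I) Complex.I s := by
        simpa using ((hasDerivAt_id s).ofReal_comp.mul_const Complex.I).const_add ((σ * u : ℝ) : ℂ)
      exact ((hΦ _).comp s h1).hasDerivWithinAt
    have hb := (convex_Icc 0 (Real.pi / 3)).norm_image_sub_le_of_norm_hasDerivWithin_le hd
      (C := Real.exp (2 * r ^ 2 / y) * Real.exp (-(y / 8) * u ^ 2)) (fun s hs ↦ ?_) hmem0 hu
    · simp only [Complex.ofReal_zero, zero_mul, add_zero] at hb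
      refine hb.trans ?_
      gcongr
      rw [sub_zero, Real.norm_of_nonneg hu.1]
      exact hu.2
    · rw [norm_mul, Complex.norm_I, mul_one]
      have := norm_besselIntegrand_le (r := r) (u := σ * u) hy ht hs
      rwa [mul_pow, hσ2, one_mul] at this
  simpa using hdiff.add hL

theorem integral_besselIntegrand_wBranch {μ μm y r t σ : ℝ} {Φ : ℂ → ℂ} {L : ℂ}
    (hμm : 0 < μm) (hμmμ : μm < μ) (hg : gContour μ μm = -1)
    (hy : 0 < y) (ht : 0 ≤ t) (hσ : σ = 1 ∨ σ = -1)
    (hΦ : ∀ z, HasDerivAt Φ (besselIntegrand ((r : ℂ) + (t : ℂ) * Complex.I) y z) z)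
    (hL : Tendsto (fun u : ℝ ↦ Φ ((σ * u : ℝ) : ℂ)) atTop (𝓝 L)) :
    ∫ u in Set.Ioi μm, besselIntegrand ((r : ℂ) + (t : ℂ) * Complex.I) y
        ((σ * u : ℝ) + (wBranch μ u : ℂ) * Complex.I) *
        ((σ : ℂ) + ((deriv (wBranch μ) u : ℝ) : ℂ) * Complex.I) =
      L - Φ ((σ * μm : ℝ) + ((3 * Real.pi / 2 : ℝ) : ℂ) * Complex.I) := by
  have hμ := hμm.trans hμmμ
  have hσ2 : σ ^ 2 = 1 := by rcases hσ with rfl | rfl <;> norm_num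
  set ν : ℂ := (r : ℂ) + (t : ℂ) * Complex.I with hν
  have hFc := (differentiable_besselIntegrand ν y).continuous
  have hΦc : Continuous Φ := continuous_iff_continuousAt.2 fun z ↦ (hΦ z).continuousAt
  obtain ⟨M, hM⟩ := eventually_atTop.1 ((eventually_wBranch_mem_Icc hμ).and
    (eventually_gt_atTop μ))
  have hMμ : μ < M := (hM M le_rfl).2
  have hMm := hμmμ.trans hMμ
  obtain ⟨hi1, he1⟩ := integral_besselIntegrand_wBranch_interval (σ := σ) hμm hμmμ hg hΦ le_rfl
    hμmμ.le fun h ↦ lt_irrefl μ h.2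
  obtain ⟨hi2, he2⟩ := integral_besselIntegrand_wBranch_interval (σ := σ) hμm hμmμ hg hΦ hμmμ.le
    hMμ.le fun h ↦ lt_irrefl μ h.1
  have hwc : ContinuousOn (wBranch μ) (Set.Ici M) :=
    (continuousOn_wBranch hμm hμmμ).mono fun u hu ↦ hMm.le.trans hu
  have hzc : ContinuousOn (fun u : ℝ ↦ ((σ * u : ℝ) : ℂ) + (wBranch μ u : ℂ) * Complex.I)
      (Set.Ici M) :=
    ContinuousOn.add (by fun_prop)
      ((Complex.continuous_ofReal.comp_continuousOn hwc).mul continuousOn_const)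
  have hd : ∀ u ∈ Set.Ioi M, HasDerivAt (wBranch μ) (deriv (wBranch μ) u) u ∧
      deriv (wBranch μ) u ≤ 0 := by
    intro u hu
    obtain ⟨d, hd, hder⟩ := exists_hasDerivAt_wBranch hμm hμmμ hg (hMm.trans hu)
      (hMμ.trans hu).ne'
    exact ⟨hder.differentiableAt.hasDerivAt, by rw [hder.deriv]; exact hd.le⟩
  have hwi : IntegrableOn (deriv (wBranch μ)) (Set.Ioi M) :=
    integrableOn_Ioi_deriv_of_nonpos (hwc M Set.self_mem_Ici) (fun u hu ↦ (hd u hu).1)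
      (fun u hu ↦ (hd u hu).2) (tendsto_wBranch_atTop hμ)
  have hmeas : AEStronglyMeasurable (fun u : ℝ ↦ besselIntegrand ν y
      (((σ * u : ℝ) : ℂ) + (wBranch μ u : ℂ) * Complex.I)) (volume.restrict (Set.Ioi M)) :=
    ((hFc.comp_continuousOn hzc).mono Set.Ioi_subset_Ici_self).aestronglyMeasurable
      measurableSet_Ioi
  have hbound : ∀ u ∈ Set.Ioi M, ‖besselIntegrand ν y
      (((σ * u : ℝ) : ℂ) + (wBranch μ u : ℂ) * Complex.I)‖ ≤
      Real.exp (2 * r ^ 2 / y) * Real.exp (-(y / 8) * u ^ 2) := by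
    intro u hu
    have := norm_besselIntegrand_le (r := r) (u := σ * u) hy ht (hM u hu.le).1
    rwa [mul_pow, hσ2, one_mul] at this
  have hFi : IntegrableOn (fun u : ℝ ↦ besselIntegrand ν y
      (((σ * u : ℝ) : ℂ) + (wBranch μ u : ℂ) * Complex.I)) (Set.Ioi M) :=
    (integrable_gaussian_bound hy r).integrableOn.mono' hmeas
      ((ae_restrict_iff' measurableSet_Ioi).2 (Eventually.of_forall hbound))
  have hFwi : IntegrableOn (fun u : ℝ ↦ besselIntegrand ν y
      (((σ * u : ℝ) : ℂ) + (wBranch μ u : ℂ) * Complex.I) *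
      (((deriv (wBranch μ) u : ℝ) : ℂ) * Complex.I)) (Set.Ioi M) := by
    refine Integrable.bdd_mul (c := Real.exp (2 * r ^ 2 / y)) (hwi.ofReal.mul_const _) hmeas
      ((ae_restrict_iff' measurableSet_Ioi).2 (Eventually.of_forall fun u hu ↦
        (hbound u hu).trans ?_))
    refine mul_le_of_le_one_right (Real.exp_pos _).le (Real.exp_le_one_iff.2 ?_)
    nlinarith [sq_nonneg u]
  have hi3 : IntegrableOn (fun u : ℝ ↦ besselIntegrand ν y
      (((σ * u : ℝ) : ℂ) + (wBranch μ u : ℂ) * Complex.I) *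
      ((σ : ℂ) + ((deriv (wBranch μ) u : ℝ) : ℂ) * Complex.I)) (Set.Ioi M) := by
    refine ((hFi.mul_const (σ : ℂ)).add hFwi).congr (Eventually.of_forall fun u ↦ ?_)
    exact (mul_add _ _ _).symm
  have he3 := integral_Ioi_of_hasDerivAt_of_tendsto
    (f := fun u : ℝ ↦ Φ (((σ * u : ℝ) : ℂ) + (wBranch μ u : ℂ) * Complex.I))
    (hΦc.comp_continuousOn hzc M Set.self_mem_Ici) (fun u hu ↦ by
      have h1 := ((hasDerivAt_id u).const_mul σ).ofReal_comp
      simp only [mul_one] at h1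
      exact (hΦ _).comp u (h1.add ((hd u hu).1.ofReal_comp.mul_const Complex.I))) hi3
    (tendsto_primitive_besselIntegrand_wBranch hμ hy ht hσ hΦ hL)
  rw [← Set.Ioc_union_Ioi_eq_Ioi hMm.le, ← Set.Ioc_union_Ioc_eq_Ioc hμmμ.le hMμ.le,
    setIntegral_union _ measurableSet_Ioi (hi1.union hi2) hi3,
    setIntegral_union (Set.Ioc_disjoint_Ioc_of_le le_rfl) measurableSet_Ioc hi1 hi2, he1, he2, he3,
    wBranch_start hμmμ hg]
  · ring
  · rw [Set.Ioc_union_Ioc_eq_Ioc hμmμ.le hMμ.le]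
    exact Set.Ioc_disjoint_Ioi le_rfl

theorem integral_besselIntegrand_inverse_interval {U : ℝ → ℝ} {a b σ y : ℝ} {ν : ℂ} {Φ : ℂ → ℂ}
    (hΦ : ∀ z, HasDerivAt Φ (besselIntegrand ν y z) z) (hab : a ≤ b)
    (hU : ContinuousOn U (Set.Icc a b))
    (hU' : (∀ x ∈ Set.Ioo a b, ∃ d : ℝ, 0 < d ∧ HasDerivAt U d x) ∨
      ∀ x ∈ Set.Ioo a b, ∃ d : ℝ, d < 0 ∧ HasDerivAt U d x) :
    IntervalIntegrable (fun w : ℝ ↦ besselIntegrand ν y ((σ * U w : ℝ) + (w : ℂ) * Complex.I) *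
        ((σ : ℂ) * ((deriv U w : ℝ) : ℂ) + Complex.I)) volume a b ∧
      ∫ w in a..b, besselIntegrand ν y ((σ * U w : ℝ) + (w : ℂ) * Complex.I) *
        ((σ : ℂ) * ((deriv U w : ℝ) : ℂ) + Complex.I) =
      Φ ((σ * U b : ℝ) + (b : ℂ) * Complex.I) - Φ ((σ * U a : ℝ) + (a : ℂ) * Complex.I) := by
  obtain ⟨hd, hi⟩ := intervalIntegrable_deriv_of_sign hab hU hU'
  refine integral_comp_mul_deriv_curve hab hΦ (differentiable_besselIntegrand ν y).continuous
    (z := fun w : ℝ ↦ (σ * U w : ℝ) + (w : ℂ) * Complex.I) ?_ (fun w hw ↦ ?_) ?_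
  · have := Complex.continuous_ofReal.comp_continuousOn (continuousOn_const.mul hU : ContinuousOn
      (fun w ↦ σ * U w) _)
    exact this.add (by fun_prop)
  · have h1 := ((hd w hw).const_mul σ).ofReal_comp
    have h2 := (hasDerivAt_id w).ofReal_comp.mul_const Complex.I
    simp only [Complex.ofReal_one, one_mul] at h2
    exact (h1.add h2).congr_deriv (by push_cast; ring)
  · have hi' : IntervalIntegrable (fun u ↦ ((deriv U u : ℝ) : ℂ)) volume a b := by
      rw [intervalIntegrable_iff] at hi ⊢
      exact hi.ofReal
    exact (hi'.const_mul _).add intervalIntegrable_const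

theorem integral_besselIntegrand_inverse {μ μm σ y : ℝ} {ν : ℂ} {Φ : ℂ → ℂ} {U : ℝ → ℝ}
    (hμm : 0 < μm) (hμmμ : μm < μ) (hg : gContour μ μm = -1)
    (hΦ : ∀ z, HasDerivAt Φ (besselIntegrand ν y z) z)
    (hU1 : ∀ w ∈ Set.Icc (-(Real.pi / 2)) (Real.pi / 2), U w ∈ Set.Icc μm μ ∧ wA μ (U w) = w)
    (hU2 : ∀ w ∈ Set.Icc (Real.pi / 2) (3 * Real.pi / 2),
      U w ∈ Set.Icc μm μ ∧ wB μ (U w) = w) :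
    ∫ w in (-(Real.pi / 2))..(3 * Real.pi / 2),
        besselIntegrand ν y ((σ * U w : ℝ) + (w : ℂ) * Complex.I) *
        ((σ : ℂ) * ((deriv U w : ℝ) : ℂ) + Complex.I) =
      Φ ((σ * μm : ℝ) + ((3 * Real.pi / 2 : ℝ) : ℂ) * Complex.I) -
        Φ ((σ * μm : ℝ) + ((-(Real.pi / 2) : ℝ) : ℂ) * Complex.I) := by
  have hπ := Real.pi_pos
  have hstart : ∀ u ∈ Set.Icc μm μ, wA μ u = -(Real.pi / 2) → u = μm := by
    intro u hu h
    by_contra hne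
    rcases hu.2.lt_or_eq with hlt | rfl
    · have := (gContour_mem_Ioo_of_lt hμm hg ⟨lt_of_le_of_ne hu.1 (Ne.symm hne), hlt⟩).1
      have := Real.neg_pi_div_two_lt_arcsin.2 this
      rw [wA] at h
      linarith
    · rw [wA_self (hμm.trans hμmμ)] at h
      linarith
  have hUa : U (-(Real.pi / 2)) = μm :=
    let h := hU1 (-(Real.pi / 2)) ⟨le_rfl, by linarith⟩
    hstart _ h.1 h.2
  have hUb : U (3 * Real.pi / 2) = μm := by
    obtain ⟨h1, h2⟩ := hU2 (3 * Real.pi / 2) ⟨by linarith, le_rfl⟩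
    refine hstart _ h1 ?_
    rw [wB] at h2
    rw [wA]
    linarith
  obtain ⟨hi1, he1⟩ := integral_besselIntegrand_inverse_interval (σ := σ) hΦ
    (by linarith : -(Real.pi / 2) ≤ Real.pi / 2) (continuousOn_wA_inverse hμm hμmμ hg hU1)
    (Or.inl fun w hw ↦ exists_hasDerivAt_wA_inverse hμm hμmμ hg hU1 hw)
  obtain ⟨hi2, he2⟩ := integral_besselIntegrand_inverse_interval (σ := σ) hΦ
    (by linarith : Real.pi / 2 ≤ 3 * Real.pi / 2) (continuousOn_wB_inverse hμm hμmμ hg hU2)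
    (Or.inr fun w hw ↦ exists_hasDerivAt_wB_inverse hμm hμmμ hg hU2 hw)
  rw [← intervalIntegral.integral_add_adjacent_intervals hi1 hi2, he1, he2, hUa, hUb]
  ring

theorem integrable_besselIntegrand_ofReal {y t : ℝ} (hy : 0 < y) (ht : 0 ≤ t) (r : ℝ) :
    Integrable fun R : ℝ ↦ besselIntegrand ((r : ℂ) + (t : ℂ) * Complex.I) y (R : ℂ) := by
  refine (integrable_gaussian_bound hy r).mono' ((differentiable_besselIntegrand _ y).continuous.comp
    Complex.continuous_ofReal).aestronglyMeasurable (Eventually.of_forall fun R ↦ ?_)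
  simpa using norm_besselIntegrand_le (r := r) (u := R) (w := 0) hy ht ⟨le_rfl, by positivity⟩

theorem exists_integral_besselIntegrand_ofReal {y r t : ℝ} {Φ : ℂ → ℂ} (hy : 0 < y) (ht : 0 ≤ t)
    (hΦ : ∀ z, HasDerivAt Φ (besselIntegrand ((r : ℂ) + (t : ℂ) * Complex.I) y z) z) :
    ∃ L L' : ℂ, Tendsto (fun u : ℝ ↦ Φ (u : ℂ)) atTop (𝓝 L) ∧
      Tendsto (fun u : ℝ ↦ Φ ((-u : ℝ) : ℂ)) atTop (𝓝 L') ∧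
      ∫ R : ℝ, besselIntegrand ((r : ℂ) + (t : ℂ) * Complex.I) y (R : ℂ) = L - L' := by
  have hi := integrable_besselIntegrand_ofReal hy ht r
  have hd : ∀ R : ℝ, HasDerivAt (fun u : ℝ ↦ Φ (u : ℂ))
      (besselIntegrand ((r : ℂ) + (t : ℂ) * Complex.I) y (R : ℂ)) R :=
    fun R ↦ (hΦ R).comp_ofReal
  have h1 := tendsto_limUnder_of_hasDerivAt_of_integrableOn_Ioi (a := 0) (fun x _ ↦ hd x)
    hi.integrableOn
  have h2 := tendsto_limUnder_of_hasDerivAt_of_integrableOn_Iic (a := 0) (fun x _ ↦ hd x)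
    hi.integrableOn
  exact ⟨_, _, h1, h2.comp tendsto_neg_atTop_atBot, integral_of_hasDerivAt_of_tendsto hd hi h2 h1⟩

theorem kbessel_novel_integral_representation (μ y r μm : ℝ) (U : ℝ → ℝ)
    (hμ : 0 < μ) (hy : 0 < y)
    (hμm : 0 < μm) (hμmμ : μm < μ) (hgμm : gContour μ μm = -1)
    (hμm_uniq : ∀ u ∈ Set.Ioo (0 : ℝ) μ, gContour μ u = -1 → u = μm)
    (hU1 : ∀ w ∈ Set.Icc (-(Real.pi / 2)) (Real.pi / 2),
      U w ∈ Set.Icc μm μ ∧ wA μ (U w) = w)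
    (hU2 : ∀ w ∈ Set.Icc (Real.pi / 2) (3 * Real.pi / 2),
      U w ∈ Set.Icc μm μ ∧ wB μ (U w) = w) :
    KBessel ((r : ℂ) + ((y * Real.cosh μ : ℝ) : ℂ) * Complex.I) y =
      (1 / 2) * Complex.exp (Complex.I * ((y * (Real.sinh μ - μ * Real.cosh μ) : ℝ) : ℂ)) *
        (∫ u in Set.Ioi μm,
          Complex.exp (-(y : ℂ) * ((ψBranch μ u : ℝ) : ℂ)) *
            Complex.exp (-(r : ℂ) * (u : ℂ)) *
            Complex.exp (Complex.I * (r : ℂ) * ((wBranch μ u : ℝ) : ℂ)) *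
            (1 - Complex.I * ((deriv (wBranch μ) u : ℝ) : ℂ)))
      + (1 / 2) * Complex.exp (Complex.I * ((y * (Real.sinh μ - μ * Real.cosh μ) : ℝ) : ℂ)) *
        (Complex.exp (((-(2 * Real.pi * (y * Real.cosh μ)) : ℝ) : ℂ) +
            2 * (Real.pi : ℂ) * (r : ℂ) * Complex.I) /
          (1 - Complex.exp (((-(2 * Real.pi * (y * Real.cosh μ)) : ℝ) : ℂ) +
            2 * (Real.pi : ℂ) * (r : ℂ) * Complex.I))) *
        (∫ w in (-(Real.pi / 2))..(3 * Real.pi / 2),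
          Complex.exp (-(y : ℂ) *
              ((Real.cosh (U w) * Real.cos w + w * Real.cosh μ : ℝ) : ℂ)) *
            Complex.exp (-(r : ℂ) * ((U w : ℝ) : ℂ)) *
            Complex.exp (Complex.I * (r : ℂ) * (w : ℂ)) *
            (-((deriv U w : ℝ) : ℂ) + Complex.I))
      + (1 / 2) * Complex.exp (-(Complex.I * ((y * (Real.sinh μ - μ * Real.cosh μ) : ℝ) : ℂ))) *
        (∫ u in Set.Ioi μm,
          Complex.exp (-(y : ℂ) * ((ψBranch μ u : ℝ) : ℂ)) *
            Complex.exp ((r : ℂ) * (u : ℂ)) *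
            Complex.exp (Complex.I * (r : ℂ) * ((wBranch μ u : ℝ) : ℂ)) *
            (1 + Complex.I * ((deriv (wBranch μ) u : ℝ) : ℂ)))
      - (1 / 2) * Complex.exp (-(Complex.I * ((y * (Real.sinh μ - μ * Real.cosh μ) : ℝ) : ℂ))) *
        (Complex.exp (((-(2 * Real.pi * (y * Real.cosh μ)) : ℝ) : ℂ) +
            2 * (Real.pi : ℂ) * (r : ℂ) * Complex.I) /
          (1 - Complex.exp (((-(2 * Real.pi * (y * Real.cosh μ)) : ℝ) : ℂ) +
            2 * (Real.pi : ℂ) * (r : ℂ) * Complex.I))) *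
        (∫ w in (-(Real.pi / 2))..(3 * Real.pi / 2),
          Complex.exp (-(y : ℂ) *
              ((Real.cosh (U w) * Real.cos w + w * Real.cosh μ : ℝ) : ℂ)) *
            Complex.exp ((r : ℂ) * ((U w : ℝ) : ℂ)) *
            Complex.exp (Complex.I * (r : ℂ) * (w : ℂ)) *
            (((deriv U w : ℝ) : ℂ) + Complex.I)) := by
  have ht : 0 ≤ y * Real.cosh μ := (mul_pos hy (Real.cosh_pos μ)).le
  set ν : ℂ := (r : ℂ) + ((y * Real.cosh μ : ℝ) : ℂ) * Complex.I with hν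
  set e : ℂ := Complex.I * ((y * (Real.sinh μ - μ * Real.cosh μ) : ℝ) : ℂ) with he
  set q : ℂ := Complex.exp (((-(2 * Real.pi * (y * Real.cosh μ)) : ℝ) : ℂ) +
    2 * (Real.pi : ℂ) * (r : ℂ) * Complex.I) with hq
  have hq1 : 1 - q ≠ 0 := by
    intro h
    have h1 : ‖q‖ < 1 := by
      rw [hq, Complex.norm_exp]
      have : 0 < 2 * Real.pi * (y * Real.cosh μ) := by
        have := Real.cosh_pos μ
        positivity
      simpa [-neg_mul] using this
    rw [← sub_eq_zero.1 h, norm_one] at h1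
    exact lt_irrefl _ h1
  have hqν : Complex.exp (2 * Real.pi * ν * Complex.I) = q := by
    rw [hq, hν]
    congr 1
    push_cast
    linear_combination 2 * (Real.pi : ℂ) * y * Complex.cosh μ * Complex.I_sq
  obtain ⟨Φ, hΦ⟩ := exists_hasDerivAt_besselIntegrand ν y
  obtain ⟨L, L', hL, hL', hK⟩ := exists_integral_besselIntegrand_ofReal hy ht hΦ
  have hK' : KBessel ν y = 1 / 2 * (L - L') := by
    rw [KBessel, ← hK]
    simp only [besselIntegrand, Complex.ofReal_cosh, hν]
  have hduPos := integral_besselIntegrand_wBranch (σ := 1) hμm hμmμ hgμm hy ht (Or.inl rfl) hΦ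
    (by simpa using hL)
  have hduNeg := integral_besselIntegrand_wBranch (σ := -1) hμm hμmμ hgμm hy ht (Or.inr rfl) hΦ
    (by simpa using hL')
  have hdwPos := integral_besselIntegrand_inverse (σ := 1) hμm hμmμ hgμm hΦ hU1 hU2
  have hdwNeg := integral_besselIntegrand_inverse (σ := -1) hμm hμmμ hgμm hΦ hU1 hU2
  have hper := primitive_besselIntegrand_add_two_pi_mul_I hΦ
    (((-1 * μm : ℝ) : ℂ) + ((-(Real.pi / 2) : ℝ) : ℂ) * Complex.I)
    (((1 * μm : ℝ) : ℂ) + ((-(Real.pi / 2) : ℝ) : ℂ) * Complex.I)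
  have hshift : ∀ x : ℂ, x + ((-(Real.pi / 2) : ℝ) : ℂ) * Complex.I + 2 * Real.pi * Complex.I =
      x + ((3 * Real.pi / 2 : ℝ) : ℂ) * Complex.I := by
    intro x
    push_cast
    ring
  rw [hqν, hshift, hshift] at hper
  have hsinU : ∀ w ∈ Set.uIcc (-(Real.pi / 2)) (3 * Real.pi / 2),
      Real.sinh (U w) * Real.sin w = U w * Real.cosh μ + Real.sinh μ - μ * Real.cosh μ := by
    intro w hw
    rw [Set.uIcc_of_le (by linarith [Real.pi_pos])] at hw
    have hsin : ∀ v, v ∈ Set.Icc μm μ → Real.sin w = Real.sin (wA μ v) →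
        Real.sinh v * Real.sin w = v * Real.cosh μ + Real.sinh μ - μ * Real.cosh μ := by
      intro v hv h
      have hgv := gContour_mem_Icc hμm hμmμ hgμm hv.1
      rw [h, wA, Real.sin_arcsin hgv.1 hgv.2, sinh_mul_gContour μ (hμm.trans_le hv.1)]
    rcases le_total w (Real.pi / 2) with h | h
    · obtain ⟨h1, h2⟩ := hU1 w ⟨hw.1, h⟩
      exact hsin _ h1 (by rw [h2])
    · obtain ⟨h1, h2⟩ := hU2 w ⟨h, hw.2⟩
      refine hsin _ h1 ?_
      rw [wB] at h2
      rw [wA, show Real.arcsin (gContour μ (U w)) = Real.pi - w by linarith, Real.sin_pi_sub]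
  rw [hK']
  have hA : Complex.exp e * (∫ u in Set.Ioi μm,
          Complex.exp (-(y : ℂ) * ((ψBranch μ u : ℝ) : ℂ)) *
            Complex.exp (-(r : ℂ) * (u : ℂ)) *
            Complex.exp (Complex.I * (r : ℂ) * ((wBranch μ u : ℝ) : ℂ)) *
            (1 - Complex.I * ((deriv (wBranch μ) u : ℝ) : ℂ))) =
      -(L' - Φ (((-1 * μm : ℝ) : ℂ) + ((3 * Real.pi / 2 : ℝ) : ℂ) * Complex.I)) := by
    rw [← hduNeg, ← integral_const_mul, ← integral_neg]
    refine setIntegral_congr_fun measurableSet_Ioi fun u hu ↦ ?_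
    simp only [ψBranch]
    rw [besselIntegrand_of_sinh_mul_sin (Or.inr rfl)
      (sinh_mul_sin_wBranch hμm hμmμ hgμm (Set.mem_Ioi.1 hu).le), ← he]
    simp only [Complex.ofReal_neg, Complex.ofReal_one, neg_neg, one_mul, neg_one_mul]
    ring
  have hC : Complex.exp (-e) * (∫ u in Set.Ioi μm,
          Complex.exp (-(y : ℂ) * ((ψBranch μ u : ℝ) : ℂ)) *
            Complex.exp ((r : ℂ) * (u : ℂ)) *
            Complex.exp (Complex.I * (r : ℂ) * ((wBranch μ u : ℝ) : ℂ)) *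
            (1 + Complex.I * ((deriv (wBranch μ) u : ℝ) : ℂ))) =
      L - Φ (((1 * μm : ℝ) : ℂ) + ((3 * Real.pi / 2 : ℝ) : ℂ) * Complex.I) := by
    rw [← hduPos, ← integral_const_mul]
    refine setIntegral_congr_fun measurableSet_Ioi fun u hu ↦ ?_
    simp only [ψBranch]
    rw [besselIntegrand_of_sinh_mul_sin (Or.inl rfl)
      (sinh_mul_sin_wBranch hμm hμmμ hgμm (Set.mem_Ioi.1 hu).le), ← he]
    simp only [Complex.ofReal_one, one_mul, neg_one_mul]
    ring
  have hB : Complex.exp e * (∫ w in (-(Real.pi / 2))..(3 * Real.pi / 2),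
          Complex.exp (-(y : ℂ) *
              ((Real.cosh (U w) * Real.cos w + w * Real.cosh μ : ℝ) : ℂ)) *
            Complex.exp (-(r : ℂ) * ((U w : ℝ) : ℂ)) *
            Complex.exp (Complex.I * (r : ℂ) * (w : ℂ)) *
            (-((deriv U w : ℝ) : ℂ) + Complex.I)) =
      Φ (((-1 * μm : ℝ) : ℂ) + ((3 * Real.pi / 2 : ℝ) : ℂ) * Complex.I) -
        Φ (((-1 * μm : ℝ) : ℂ) + ((-(Real.pi / 2) : ℝ) : ℂ) * Complex.I) := by
    rw [← hdwNeg, ← intervalIntegral.integral_const_mul]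
    refine intervalIntegral.integral_congr fun w hw ↦ ?_
    rw [besselIntegrand_of_sinh_mul_sin (Or.inr rfl) (hsinU w hw), ← he]
    simp only [Complex.ofReal_neg, Complex.ofReal_one, neg_neg, one_mul, neg_one_mul]
    ring
  have hD : Complex.exp (-e) * (∫ w in (-(Real.pi / 2))..(3 * Real.pi / 2),
          Complex.exp (-(y : ℂ) *
              ((Real.cosh (U w) * Real.cos w + w * Real.cosh μ : ℝ) : ℂ)) *
            Complex.exp ((r : ℂ) * ((U w : ℝ) : ℂ)) *
            Complex.exp (Complex.I * (r : ℂ) * (w : ℂ)) *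
            (((deriv U w : ℝ) : ℂ) + Complex.I)) =
      Φ (((1 * μm : ℝ) : ℂ) + ((3 * Real.pi / 2 : ℝ) : ℂ) * Complex.I) -
        Φ (((1 * μm : ℝ) : ℂ) + ((-(Real.pi / 2) : ℝ) : ℂ) * Complex.I) := by
    rw [← hdwPos, ← intervalIntegral.integral_const_mul]
    refine intervalIntegral.integral_congr fun w hw ↦ ?_
    rw [besselIntegrand_of_sinh_mul_sin (Or.inl rfl) (hsinU w hw), ← he]
    simp only [Complex.ofReal_one, one_mul, neg_one_mul]
    ring
  have hquot : q / (1 - q) * (1 - q) = q := div_mul_cancel₀ q hq1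
  linear_combination (-(1 / 2)) * hA - (1 / 2) * (q / (1 - q)) * hB - (1 / 2) * hC +
    (1 / 2) * (q / (1 - q)) * hD - (1 / 2) * hper - (1 / 2) * (q / (1 - q)) * hper +
    (1 / 2) * (Φ (((-1 * μm : ℝ) : ℂ) + ((-(Real.pi / 2) : ℝ) : ℂ) * Complex.I) -
      Φ (((1 * μm : ℝ) : ℂ) + ((-(Real.pi / 2) : ℝ) : ℂ) * Complex.I)) * hquot
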